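/- Assume 2 ≤ d_1 ≤ d_2 ≤ ⋯ ≤ d_n and write d = ∑_{i=1}^k (d_i − 1) + ℓ with 0 ≤ k < n and 0 < ℓ ≤ d_{k+1} − 1. Let r := d_s − δ + 1. If d_s ≤ d_{k+1} and 0 ≤ d_s − (d_{k+1} − ℓ) < r, then W^(1)(D_X^{(δ,s)}(d)) = W^(1)(C_X(d)) = (d_{k+1} − ℓ)·∏_{i=k+2}^n d_i. -/

import Mathlib

namespace QACC

open MvPolynomial

noncomputable section

variable {F : Type} [Field F] [Fintype F] [DecidableEq F]

/-- The points of the cartesian set `X = K 0 × ⋯ × K (n-1)`, as a subtype. -/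
abbrev cartPoint {n : ℕ} (K : Fin n → Set F) : Type _ :=
  {α : Fin n → F // ∀ i, α i ∈ K i}

noncomputable instance {n : ℕ} (K : Fin n → Set F) : Fintype (cartPoint K) :=
  Fintype.ofFinite _

/-- The evaluation linear map `Ψ` sending a polynomial to its vector of values at points of X. -/
def evalX {n : ℕ} (K : Fin n → Set F) :
    MvPolynomial (Fin n) F →ₗ[F] (cartPoint K → F) where
  toFun f := fun x => eval x.1 f
  map_add' f g := by funext x; simp
  map_smul' c f := by funext x; simp

/-- The affine cartesian code `C_X(d)`: evaluations of polynomials of total degree `≤ d`. -/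
def cartCode {n : ℕ} (K : Fin n → Set F) (d : ℕ) : Submodule F (cartPoint K → F) :=
  (restrictTotalDegree (Fin n) F d).map (evalX K)

/-- The space `P_d^{(δ,s)}` of polynomials of total degree `≤ d` with degree in `X s`
at most `|K s| - δ`. -/
def quasiPoly (n : ℕ) (K : Fin n → Set F) (d δ : ℕ) (s : Fin n) :
    Submodule F (MvPolynomial (Fin n) F) where
  carrier := {f | f.totalDegree ≤ d ∧ f.degreeOf s ≤ (K s).ncard - δ}
  zero_mem' := by simp
  add_mem' := by
    rintro f g ⟨hf1, hf2⟩ ⟨hg1, hg2⟩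
    exact ⟨le_trans (totalDegree_add f g) (max_le hf1 hg1),
      le_trans (degreeOf_add_le s f g) (max_le hf2 hg2)⟩
  smul_mem' := by
    rintro c f ⟨hf1, hf2⟩
    refine ⟨le_trans (totalDegree_smul_le c f) hf1, ?_⟩
    calc (c • f).degreeOf s = (C c * f).degreeOf s := by rw [smul_eq_C_mul]
      _ ≤ (C c).degreeOf s + f.degreeOf s := degreeOf_mul_le s (C c) f
      _ ≤ (K s).ncard - δ := by simpa [degreeOf_C] using hf2

/-- The `(δ,s)`-quasi affine cartesian code `D_X^{(δ,s)}(d)`. -/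
def quasiCode {n : ℕ} (K : Fin n → Set F) (d δ : ℕ) (s : Fin n) :
    Submodule F (cartPoint K → F) :=
  (quasiPoly n K d δ s).map (evalX K)

/-- The minimum distance (minimum Hamming weight of a nonzero codeword) of a linear code. -/
def minDist {ι : Type} [Fintype ι] (C : Submodule F (ι → F)) : ℕ :=
  sInf {w | ∃ v ∈ C, v ≠ 0 ∧ hammingNorm v = w}


lemma exists_eval_sub_eval_update_monomial {σ R : Type*} [CommRing R] [DecidableEq σ] (i : σ)
    (a : R) (b : σ →₀ ℕ) (c : R) :
    ∃ g : MvPolynomial σ R, g.totalDegree ≤ b.degree - 1 ∧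
      ∀ x : σ → R, eval x (monomial b c) =
        eval (Function.update x i a) (monomial b c) + (x i - a) * eval x g := by
  refine ⟨∑ j ∈ Finset.range (b i),
    monomial (b.erase i + Finsupp.single i j) (c * a ^ (b i - 1 - j)), ?_, fun x => ?_⟩
  · refine (totalDegree_finsetSum_le fun j hj => ?_)
    refine (totalDegree_monomial_le _ _).trans ?_
    have hb : b.degree = (b.erase i).degree + b i := by
      conv_lhs => rw [← Finsupp.erase_add_single i b]
      simp
    have hj' := Finset.mem_range.1 hj
    change Finsupp.degree (b.erase i + Finsupp.single i j) ≤ _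
    simp only [map_add, Finsupp.degree_single]
    omega
  · have key : ∀ y : σ → R, ∀ j : ℕ,
        ((b.erase i + Finsupp.single i j).prod fun k e => y k ^ e) =
          ((b.erase i).prod fun k e => y k ^ e) * y i ^ j := by
      intro y j
      rw [Finsupp.prod_add_index' (by simp) (by simp [pow_add])]
      simp
    have hb (y : σ → R) : (b.prod fun k e => y k ^ e) =
        ((b.erase i).prod fun k e => y k ^ e) * y i ^ (b i) := by
      rw [← key, Finsupp.erase_add_single]
    have hu : ((b.erase i).prod fun k e => Function.update x i a k ^ e) =
        (b.erase i).prod fun k e => x k ^ e := by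
      refine Finsupp.prod_congr fun k hk => ?_
      have : k ≠ i := by
        rintro rfl
        simp at hk
      simp [this]
    simp only [eval_monomial, map_sum, key, hb, hu, Function.update_self]
    have hg := geom_sum₂_mul (x i) a (b i)
    have hs : ∑ j ∈ Finset.range (b i), c * a ^ (b i - 1 - j) *
        (((b.erase i).prod fun k e => x k ^ e) * x i ^ j) =
        c * ((b.erase i).prod fun k e => x k ^ e) *
          ∑ j ∈ Finset.range (b i), x i ^ j * a ^ (b i - 1 - j) := by
      rw [Finset.mul_sum]
      exact Finset.sum_congr rfl fun j _ => by ring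
    rw [hs]
    linear_combination (-c * ((b.erase i).prod fun k e => x k ^ e)) * hg

/-- Division of a polynomial by `X i - a`, with remainder its restriction to `X i = a`. -/
lemma exists_eval_eq_eval_update_add {σ R : Type*} [CommRing R] [DecidableEq σ] (i : σ) (a : R)
    (f : MvPolynomial σ R) :
    ∃ g : MvPolynomial σ R, g.totalDegree ≤ f.totalDegree - 1 ∧
      ∀ x : σ → R, eval x f = eval (Function.update x i a) f + (x i - a) * eval x g := by
  choose g hg hgx using fun b => exists_eval_sub_eval_update_monomial i a b (f.coeff b)
  refine ⟨∑ b ∈ f.support, g b, totalDegree_finsetSum_le fun b hb => (hg b).trans ?_,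
    fun x => ?_⟩
  · exact Nat.sub_le_sub_right (le_totalDegree hb) 1
  · conv_lhs => rw [f.as_sum]
    conv_rhs => enter [1]; rw [f.as_sum]
    simp only [map_sum]
    rw [Finset.mul_sum, ← Finset.sum_add_distrib]
    exact Finset.sum_congr rfl fun b _ => hgx b x

/-- The Alon–Füredi theorem: a polynomial that does not vanish identically on a finite grid is
nonzero at no fewer than `∏ i, m i` of its points, for some `m` with `1 ≤ m i ≤ #(S i)` and
`∑ i, (#(S i) - m i) ≤ f.totalDegree`. -/
theorem exists_prod_le_card_eval_ne_zero {σ R : Type*} [Fintype σ] [DecidableEq σ] [CommRing R]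
    [IsDomain R] [DecidableEq R] (N : ℕ) (S : σ → Finset R) (hN : ∑ i, (S i).card ≤ N)
    (f : MvPolynomial σ R) (d : ℕ) (hf : f.totalDegree ≤ d)
    (hne : ∃ x ∈ Fintype.piFinset S, eval x f ≠ 0) :
    ∃ m : σ → ℕ, (∀ i, 1 ≤ m i ∧ m i ≤ (S i).card) ∧
      ∑ i, (S i).card ≤ d + ∑ i, m i ∧
      ∏ i, m i ≤ ((Fintype.piFinset S).filter fun x => eval x f ≠ 0).card := by
  induction N generalizing S f d with
  | zero =>
    obtain ⟨x, hx, hxf⟩ := hne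
    have hpos : ∀ i, 0 < (S i).card := fun i =>
      Finset.card_pos.2 ⟨x i, Fintype.mem_piFinset.1 hx i⟩
    refine ⟨fun i => (S i).card, fun i => ⟨hpos i, le_rfl⟩, by omega, ?_⟩
    have : ∀ i, (S i).card = 0 := by simpa using hN
    have hem : IsEmpty σ := ⟨fun i => (hpos i).ne' (this i)⟩
    simp only [Finset.univ_eq_empty, Finset.prod_empty]
    exact Finset.card_pos.2 ⟨x, Finset.mem_filter.2 ⟨hx, hxf⟩⟩
  | succ N ih =>
    obtain ⟨x, hx, hxf⟩ := hne
    have hxS := Fintype.mem_piFinset.1 hx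
    have hpos : ∀ i, 0 < (S i).card := fun i => Finset.card_pos.2 ⟨x i, hxS i⟩
    by_cases hone : ∀ i, (S i).card = 1
    · refine ⟨fun _ => 1, fun i => ⟨le_rfl, hpos i⟩, by simp [hone], ?_⟩
      simp only [Finset.prod_const_one]
      exact Finset.card_pos.2 ⟨x, Finset.mem_filter.2 ⟨hx, hxf⟩⟩
    push Not at hone
    obtain ⟨i, hi⟩ := hone
    have hi2 : 2 ≤ (S i).card := by have := hpos i; omega
    have hsum (T : Finset R) : ∑ j, (Function.update S i T j).card + (S i).card =
        ∑ j, (S j).card + T.card := by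
      rw [← Finset.add_sum_erase _ _ (Finset.mem_univ i),
        ← Finset.add_sum_erase _ (fun j => (S j).card) (Finset.mem_univ i),
        Finset.sum_congr rfl fun j hj => by
          rw [Function.update_of_ne (Finset.ne_of_mem_erase hj)]]
      simp only [Function.update_self]
      omega
    have hmem (T : Finset R) (y : σ → R) : y ∈ Fintype.piFinset (Function.update S i T) ↔
        y i ∈ T ∧ ∀ j, j ≠ i → y j ∈ S j := by
      simp only [Fintype.mem_piFinset]
      constructor
      · intro h
        exact ⟨by simpa using h i, fun j hj => by simpa [hj] using h j⟩
      · rintro ⟨h1, h2⟩ j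
        by_cases hj : j = i
        · subst hj; simpa using h1
        · simpa [hj] using h2 j hj
    by_cases hslice : ∃ a ∈ S i, ∀ y ∈ Fintype.piFinset (Function.update S i {a}), eval y f = 0
    · obtain ⟨a, ha, hya⟩ := hslice
      obtain ⟨g, hg, hgx⟩ := exists_eval_eq_eval_update_add i a f
      have hfg : ∀ y ∈ Fintype.piFinset S, eval y f = (y i - a) * eval y g := by
        intro y hy
        rw [hgx y, hya, zero_add]
        rw [hmem]
        exact ⟨by simp, fun j hj => by simpa [hj] using Fintype.mem_piFinset.1 hy j⟩
      have hd : 1 ≤ f.totalDegree := by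
        by_contra hd
        rw [Nat.not_le, Nat.lt_one_iff, totalDegree_eq_zero_iff_eq_C] at hd
        have h0 := hya (Function.update x i a) <| by
          rw [hmem]
          exact ⟨by simp, fun j hj => by simpa [hj] using hxS j⟩
        rw [hd] at h0 hxf
        simp only [eval_C] at h0 hxf
        exact hxf h0
      have hcard := hsum ((S i).erase a)
      rw [Finset.card_erase_of_mem ha] at hcard
      obtain ⟨m, hm, hms, hmp⟩ := ih (Function.update S i ((S i).erase a)) (by omega) g (d - 1)
        (by omega) ⟨x, by
          rw [hmem]
          refine ⟨Finset.mem_erase.2 ⟨?_, hxS i⟩, fun j _ => hxS j⟩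
          rintro h
          apply hxf
          rw [hfg x hx, h, sub_self, zero_mul], by
          intro h
          apply hxf
          rw [hfg x hx, h, mul_zero]⟩
      refine ⟨m, fun j => ⟨(hm j).1, (hm j).2.trans ?_⟩, by omega,
        hmp.trans (Finset.card_le_card ?_)⟩
      · by_cases hj : j = i
        · subst hj; simpa using Finset.card_le_card (Finset.erase_subset a (S j))
        · simp [hj]
      · intro y hy
        rw [Finset.mem_filter, hmem, Finset.mem_erase] at hy
        obtain ⟨⟨⟨hya', hyi⟩, hyj⟩, hyg⟩ := hy
        have hyS : y ∈ Fintype.piFinset S := Fintype.mem_piFinset.2 fun j => by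
          by_cases hj : j = i
          · exact hj ▸ hyi
          · exact hyj j hj
        rw [Finset.mem_filter, hfg y hyS]
        exact ⟨hyS, mul_ne_zero (sub_ne_zero.2 hya') hyg⟩
    · push Not at hslice
      have hrec : ∀ a ∈ S i, ∃ m : σ → ℕ,
          (∀ j, 1 ≤ m j ∧ m j ≤ (Function.update S i {a} j).card) ∧
          ∑ j, (Function.update S i {a} j).card ≤ d + ∑ j, m j ∧
          ∏ j, m j ≤ ((Fintype.piFinset (Function.update S i {a})).filter
            fun x => eval x f ≠ 0).card := by
        intro a ha
        have hcard := hsum {a}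
        rw [Finset.card_singleton] at hcard
        exact ih _ (by omega) f d hf (hslice a ha)
      choose! m hm hms hmp using hrec
      obtain ⟨a, ha, hmin⟩ := Finset.exists_min_image (S i) (fun a => ∏ j, m a j)
        (Finset.card_pos.1 (hpos i))
      have hmi : m a i = 1 := by
        have := hm a ha i
        simp only [Function.update_self, Finset.card_singleton] at this
        omega
      have hcard := hsum {a}
      rw [Finset.card_singleton] at hcard
      refine ⟨Function.update (m a) i (S i).card, fun j => ?_, ?_, ?_⟩
      · by_cases hj : j = i
        · subst hj; simpa using hpos j
        · simpa [hj] using hm a ha j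
      · rw [Finset.sum_update_of_mem (Finset.mem_univ i)]
        have h1 := hms a ha
        rw [← Finset.add_sum_erase _ (m a) (Finset.mem_univ i), hmi] at h1
        rw [← Finset.erase_eq]
        omega
      · rw [Finset.prod_update_of_mem (Finset.mem_univ i), ← Finset.erase_eq]
        have h1 : ∏ j, m a j = ∏ j ∈ Finset.univ.erase i, m a j := by
          rw [← Finset.mul_prod_erase _ (m a) (Finset.mem_univ i), hmi, one_mul]
        rw [← h1, Finset.card_eq_sum_card_fiberwise (f := fun x : σ → R => x i) (t := S i),
          ← smul_eq_mul]
        · refine Finset.card_nsmul_le_sum _ _ _ fun b hb => ?_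
          refine (hmin b hb).trans ((hmp b hb).trans (Finset.card_le_card fun y hy => ?_))
          simp only [Finset.mem_filter, hmem, Finset.mem_singleton] at hy
          obtain ⟨⟨hyb, hyj⟩, hyf⟩ := hy
          refine Finset.mem_filter.2 ⟨Finset.mem_filter.2 ⟨Fintype.mem_piFinset.2 fun j => ?_,
            hyf⟩, hyb⟩
          by_cases hj : j = i
          · subst hj; exact hyb ▸ hb
          · exact hyj j hj
        · intro y hy
          exact Fintype.mem_piFinset.1 (Finset.mem_filter.1 hy).1 i

lemma prod_update_update {ι M : Type*} [Fintype ι] [DecidableEq ι] [CommMonoid M] (m : ι → M)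
    {i j : ι} (hij : i ≠ j) (a b : M) :
    ∏ k, Function.update (Function.update m i a) j b k =
      a * b * ∏ k ∈ (Finset.univ.erase i).erase j, m k := by
  rw [← Finset.mul_prod_erase _ _ (Finset.mem_univ i),
    ← Finset.mul_prod_erase _ _ (Finset.mem_erase.2 ⟨hij.symm, Finset.mem_univ j⟩),
    Finset.prod_congr rfl fun k hk => by
      rw [Function.update_of_ne (Finset.ne_of_mem_erase hk),
        Function.update_of_ne (Finset.ne_of_mem_erase (Finset.mem_of_mem_erase hk))]]
  simp [hij, mul_assoc]

lemma sum_update_update {ι M : Type*} [Fintype ι] [DecidableEq ι] [AddCommMonoid M] (m : ι → M)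
    {i j : ι} (hij : i ≠ j) (a b : M) :
    ∑ k, Function.update (Function.update m i a) j b k =
      a + b + ∑ k ∈ (Finset.univ.erase i).erase j, m k :=
  prod_update_update (M := Multiplicative M) m hij a b

/-- Shifting weight towards larger indices does not increase the product, so a bounded vector may
be replaced by one of the form `(1, …, 1, *, c, …, c)`. -/
lemma exists_canonical_prod_le {n : ℕ} (c : Fin n → ℕ) (hc : Monotone c) (N : ℕ) (m : Fin n → ℕ)
    (hN : ∑ i, (c i - m i) * (i : ℕ) ≤ N) (hm : ∀ i, 1 ≤ m i ∧ m i ≤ c i) :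
    ∃ m' : Fin n → ℕ, (∀ i, 1 ≤ m' i ∧ m' i ≤ c i) ∧ ∑ i, m' i = ∑ i, m i ∧
      ∏ i, m' i ≤ ∏ i, m i ∧ ∀ i j, i < j → m' j < c j → m' i = 1 := by
  induction N using Nat.strong_induction_on generalizing m with
  | _ N ih =>
  by_cases h : ∀ i j, i < j → m j < c j → m i = 1
  · exact ⟨m, hm, rfl, le_rfl, h⟩
  push Not at h
  obtain ⟨i, j, hij, hj, hi⟩ := h
  have hne := hij.ne
  have hmi := hm i
  have hmj := hm j
  have hcij := hc hij.le
  obtain ⟨a, b, hab, ha1, hbj, hai, hbi⟩ : ∃ a b, a + b = m i + m j ∧ 1 ≤ a ∧ m j < b ∧ m i ≤ b ∧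
      b ≤ c j :=
    ⟨m i + m j - min (c j) (m i + m j - 1), min (c j) (m i + m j - 1), by omega, by omega,
      by omega, by omega, by omega⟩
  have hself : Function.update (Function.update m i (m i)) j (m j) = m := by simp
  have hprod := prod_update_update m hne
  have hsum := sum_update_update m hne
  have hp0 := hprod (m i) (m j)
  have hs0 := hsum (m i) (m j)
  rw [hself] at hp0 hs0
  set m₁ := Function.update (Function.update m i a) j b with hm₁
  have hm₁i : m₁ i = a := by simp [m₁, hne]
  have hm₁j : m₁ j = b := by simp [m₁]
  have hm₁k (k) (hki : k ≠ i) (hkj : k ≠ j) : m₁ k = m k := by simp [m₁, hki, hkj]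
  have hm₁' : ∀ k, 1 ≤ m₁ k ∧ m₁ k ≤ c k := by
    intro k
    by_cases hkj : k = j
    · subst hkj; omega
    by_cases hki : k = i
    · subst hki; omega
    rw [hm₁k k hki hkj]
    exact hm k
  have hdec : ∑ k, (c k - m₁ k) * (k : ℕ) < ∑ k, (c k - m k) * (k : ℕ) := by
    have hji : j ∈ Finset.univ.erase i := Finset.mem_erase.2 ⟨hne.symm, Finset.mem_univ j⟩
    rw [← Finset.add_sum_erase _ _ (Finset.mem_univ i), ← Finset.add_sum_erase _ _ hji,
      ← Finset.add_sum_erase _ (fun k => (c k - m k) * (k : ℕ)) (Finset.mem_univ i),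
      ← Finset.add_sum_erase _ (fun k => (c k - m k) * (k : ℕ)) hji,
      Finset.sum_congr rfl fun k hk => by
        rw [hm₁k k (Finset.ne_of_mem_erase (Finset.mem_of_mem_erase hk))
          (Finset.ne_of_mem_erase hk)], hm₁i, hm₁j, ← add_assoc, ← add_assoc]
    refine Nat.add_lt_add_right ?_ _
    have hijn : (i : ℕ) < j := hij
    obtain ⟨u, hu⟩ : ∃ u, b = m j + u := ⟨b - m j, by omega⟩
    have e1 : c i - a = c i - m i + u := by omega
    have e2 : c j - m j = c j - b + u := by omega
    have hu0 : 0 < u := by omega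
    rw [e1, e2]
    nlinarith
  obtain ⟨m', h1, h2, h3, h4⟩ := ih _ (hdec.trans_le hN) m₁ le_rfl hm₁'
  refine ⟨m', h1, by rw [h2, hsum, hs0, hab], h3.trans ?_, h4⟩
  rw [hprod, hp0]
  refine Nat.mul_le_mul_right _ ?_
  obtain ⟨u, hu⟩ : ∃ u, b = m j + u := ⟨b - m j, by omega⟩
  have hau : m i = a + u := by omega
  rw [hu, hau]
  nlinarith [Nat.mul_le_mul_left u (show a ≤ m j by omega)]

/-- The minimum of `∏ i, m i` over the vectors `1 ≤ m ≤ c` of sum at least `∑ i, c i - d`. -/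
lemma mul_prod_le_prod {n : ℕ} (c : Fin n → ℕ) (hc : Monotone c) (m : Fin n → ℕ)
    (hm : ∀ i, 1 ≤ m i ∧ m i ≤ c i) (k : Fin n) (ℓ : ℕ) (hℓ : ℓ ≤ c k - 1)
    (hsum : ∑ i, c i ≤ ∑ i ∈ Finset.univ.filter (fun i : Fin n => (i : ℕ) < k), (c i - 1) + ℓ +
      ∑ i, m i) :
    (c k - ℓ) * ∏ i ∈ Finset.univ.filter (fun i : Fin n => (k : ℕ) + 1 ≤ i), c i ≤ ∏ i, m i := by
  obtain ⟨m', hm', hs, hp, hcan⟩ := exists_canonical_prod_le c hc _ m le_rfl hm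
  refine le_trans ?_ hp
  rw [← hs] at hsum
  clear hp hs hm m
  have hsub : ∑ i, (c i - m' i) ≤
      ∑ i ∈ Finset.univ.filter (fun i : Fin n => (i : ℕ) < k), (c i - 1) + ℓ := by
    have : ∑ i, (c i - m' i) + ∑ i, m' i = ∑ i, c i := by
      rw [← Finset.sum_add_distrib]
      exact Finset.sum_congr rfl fun i _ => Nat.sub_add_cancel (hm' i).2
    omega
  have hgt : ∀ j, k < j → m' j = c j := by
    intro j hkj
    by_contra hne
    have hlt : m' j < c j := lt_of_le_of_ne (hm' j).2 hne
    have hone : ∀ i, i ≤ k → m' i = 1 := fun i hi => hcan i j (hi.trans_lt hkj) hlt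
    have hk' : k ∉ Finset.univ.filter (fun i : Fin n => (i : ℕ) < k) := by simp
    have hj' : j ∉ insert k (Finset.univ.filter (fun i : Fin n => (i : ℕ) < k)) := by
      simp only [Finset.mem_insert, Finset.mem_filter, Finset.mem_univ, true_and]
      have := Fin.lt_def.1 hkj
      rintro (h | h)
      · exact hkj.ne' h
      · omega
    have hle := Finset.sum_le_univ_sum_of_nonneg (s := insert j (insert k
      (Finset.univ.filter (fun i : Fin n => (i : ℕ) < k)))) (f := fun i => c i - m' i)
      fun i => Nat.zero_le _
    rw [Finset.sum_insert hj', Finset.sum_insert hk', hone k le_rfl,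
      Finset.sum_congr rfl fun i hi => by
        rw [hone i (Finset.mem_filter.1 hi).2.le]] at hle
    omega
  have hmk : c k - ℓ ≤ m' k := by
    by_contra hlt
    have hone : ∀ i, i < k → m' i = 1 := fun i hi => hcan i k hi (by omega)
    have hk' : k ∉ Finset.univ.filter (fun i : Fin n => (i : ℕ) < k) := by simp
    have hle := Finset.sum_le_univ_sum_of_nonneg (s := insert k
      (Finset.univ.filter (fun i : Fin n => (i : ℕ) < k))) (f := fun i => c i - m' i)
      fun i => Nat.zero_le _
    rw [Finset.sum_insert hk', Finset.sum_congr rfl fun i hi => by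
        rw [hone i (Finset.mem_filter.1 hi).2]] at hle
    omega
  have hk' : k ∉ Finset.univ.filter (fun i : Fin n => (k : ℕ) + 1 ≤ i) := by simp
  calc (c k - ℓ) * ∏ i ∈ Finset.univ.filter (fun i : Fin n => (k : ℕ) + 1 ≤ i), c i
      ≤ m' k * ∏ i ∈ Finset.univ.filter (fun i : Fin n => (k : ℕ) + 1 ≤ i), m' i := by
        refine Nat.mul_le_mul hmk (Finset.prod_le_prod' fun i hi => (hgt i ?_).ge)
        exact Fin.lt_def.2 (Finset.mem_filter.1 hi).2
    _ = ∏ i ∈ insert k (Finset.univ.filter (fun i : Fin n => (k : ℕ) + 1 ≤ i)), m' i := by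
        rw [Finset.prod_insert hk']
    _ ≤ ∏ i, m' i := Finset.prod_le_univ_prod_of_one_le' fun i => (hm' i).1

lemma quasiCode_le_cartCode {n : ℕ} (K : Fin n → Set F) (d δ : ℕ) (s : Fin n) :
    quasiCode K d δ s ≤ cartCode K d :=
  Submodule.map_mono fun f hf => by
    rw [mem_restrictTotalDegree]
    exact hf.1

lemma exists_mem_quasiCode_hammingNorm_le {n : ℕ} (K : Fin n → Set F) (d δ : ℕ) (s : Fin n)
    (m : Fin n → ℕ) (hm : ∀ i, 1 ≤ m i ∧ m i ≤ (K i).ncard)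
    (hd : ∑ i, (K i).ncard ≤ d + ∑ i, m i) (hs : δ ≤ m s) :
    ∃ v ∈ quasiCode K d δ s, v ≠ 0 ∧ hammingNorm v ≤ ∏ i, m i := by
  classical
  have hT (i : Fin n) : ∃ T : Finset F, T ⊆ (K i).toFinset ∧ T.card = m i :=
    Finset.exists_subset_card_eq (by
      rw [← Set.ncard_eq_toFinset_card']
      exact (hm i).2)
  choose T hTK hTm using hT
  have hTc (i : Fin n) : ((K i).toFinset \ T i).card = (K i).ncard - m i := by
    rw [Finset.card_sdiff_of_subset (hTK i), hTm, ← Set.ncard_eq_toFinset_card']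
  let f : MvPolynomial (Fin n) F := ∏ i, ∏ a ∈ (K i).toFinset \ T i, (X i - C a)
  have hf0 (x : cartPoint K) : eval x.1 f ≠ 0 ↔ ∀ i, x.1 i ∈ T i := by
    simp only [f, map_prod, map_sub, eval_X, eval_C, Finset.prod_ne_zero_iff, sub_ne_zero,
      Finset.mem_univ, true_imp_iff]
    refine forall_congr' fun i => ⟨fun h => ?_, fun h a ha hxa => ?_⟩
    · by_contra hx
      exact h (x.1 i) (Finset.mem_sdiff.2 ⟨Set.mem_toFinset.2 (x.2 i), hx⟩) rfl
    · exact (Finset.mem_sdiff.1 ha).2 (hxa ▸ h)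
  have hlin (i : Fin n) (a : F) : (X i - C a : MvPolynomial (Fin n) F).totalDegree ≤ 1 := by
    refine (totalDegree_sub_C_le _ _).trans ?_
    rw [totalDegree_X]
  have hft : f.totalDegree ≤ d := by
    have h1 : f.totalDegree ≤ ∑ i, ((K i).ncard - m i) := by
      refine (totalDegree_finsetProd _ _).trans (Finset.sum_le_sum fun i _ => ?_)
      refine (totalDegree_finsetProd _ _).trans ((Finset.sum_le_sum fun a _ => hlin i a).trans ?_)
      simp [hTc]
    have h2 : ∑ i, ((K i).ncard - m i) + ∑ i, m i = ∑ i, (K i).ncard := by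
      rw [← Finset.sum_add_distrib]
      exact Finset.sum_congr rfl fun i _ => Nat.sub_add_cancel (hm i).2
    omega
  have hfs : f.degreeOf s ≤ (K s).ncard - δ := by
    have hz (i : Fin n) (hi : i ≠ s) :
        (∏ a ∈ (K i).toFinset \ T i, (X i - C a : MvPolynomial (Fin n) F)).degreeOf s = 0 := by
      refine Nat.le_zero.1 ((degreeOf_prod_le _ _ _).trans (Finset.sum_nonpos fun a _ => ?_))
      refine (degreeOf_sub_le _ _ _).trans ?_
      simp [degreeOf_C, degreeOf_X_of_ne hi.symm]
    refine (degreeOf_prod_le _ _ _).trans ?_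
    rw [Finset.sum_eq_single s (fun i _ hi => hz i hi) (by simp)]
    refine (degreeOf_le_totalDegree _ _).trans ((totalDegree_finsetProd _ _).trans
      ((Finset.sum_le_sum fun a _ => hlin s a).trans ?_))
    simp only [Finset.sum_const, hTc, smul_eq_mul, mul_one]
    omega
  refine ⟨evalX K f, Submodule.mem_map_of_mem ⟨hft, hfs⟩, ?_, ?_⟩
  · have hne (i : Fin n) : (T i).Nonempty := Finset.card_pos.1 ((hTm i).symm ▸ (hm i).1)
    choose y hy using hne
    intro h
    exact (hf0 ⟨y, fun i => Set.mem_toFinset.1 (hTK i (hy i))⟩).2 hy (congrFun h _)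
  · rw [← Finset.prod_congr rfl fun i _ => hTm i, ← Fintype.card_piFinset]
    refine Finset.card_le_card_of_injOn Subtype.val (fun x hx => ?_) Subtype.val_injective.injOn
    exact Fintype.mem_piFinset.2 ((hf0 x).1 (Finset.mem_filter.1 hx).2)

lemma exists_prod_le_hammingNorm {n : ℕ} (K : Fin n → Set F) (d : ℕ) (v : cartPoint K → F)
    (hv : v ∈ cartCode K d) (hv0 : v ≠ 0) :
    ∃ m : Fin n → ℕ, (∀ i, 1 ≤ m i ∧ m i ≤ (K i).ncard) ∧
      ∑ i, (K i).ncard ≤ d + ∑ i, m i ∧ ∏ i, m i ≤ hammingNorm v := by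
  classical
  obtain ⟨f, hf, rfl⟩ := hv
  obtain ⟨x, hx⟩ := Function.ne_iff.1 hv0
  obtain ⟨m, h1, h2, h3⟩ := exists_prod_le_card_eval_ne_zero _ (fun i => (K i).toFinset) le_rfl f d
    ((mem_restrictTotalDegree _ _ _).1 hf)
    ⟨x.1, Fintype.mem_piFinset.2 fun i => Set.mem_toFinset.2 (x.2 i), hx⟩
  simp only [← Set.ncard_eq_toFinset_card'] at h1 h2
  refine ⟨m, h1, h2, h3.trans ?_⟩
  rw [hammingNorm, ← Finset.card_image_of_injective _ Subtype.val_injective]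
  refine Finset.card_le_card fun y hy => ?_
  obtain ⟨hy1, hy2⟩ := Finset.mem_filter.1 hy
  exact Finset.mem_image.2 ⟨⟨y, fun i => Set.mem_toFinset.1 (Fintype.mem_piFinset.1 hy1 i)⟩,
    Finset.mem_filter.2 ⟨Finset.mem_univ _, hy2⟩, rfl⟩

lemma minDist_eq_of_le {ι : Type} [Fintype ι] (C : Submodule F (ι → F)) (w : ℕ)
    (hlow : ∀ v ∈ C, v ≠ 0 → w ≤ hammingNorm v)
    (hup : ∃ v ∈ C, v ≠ 0 ∧ hammingNorm v ≤ w) : minDist C = w := by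
  obtain ⟨v, hv, hv0, hvw⟩ := hup
  refine le_antisymm (le_trans (Nat.sInf_le (m := hammingNorm v) ⟨v, hv, hv0, rfl⟩) hvw) ?_
  refine le_csInf ⟨hammingNorm v, v, hv, hv0, rfl⟩ ?_
  rintro _ ⟨u, hu, hu0, rfl⟩
  exact hlow u hu hu0

/-- The bound of `mul_prod_le_prod` is attained by a vector whose entry at `s` is `c k - ℓ`. -/
lemma exists_vector_attaining {n : ℕ} (c : Fin n → ℕ) (hc1 : ∀ i, 1 ≤ c i)
    (s k : Fin n) (ℓ : ℕ) (hℓ : ℓ ≤ c k - 1) (hsk : c s ≤ c k) (hts : c k - ℓ ≤ c s) :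
    ∃ m : Fin n → ℕ, (∀ i, 1 ≤ m i ∧ m i ≤ c i) ∧
      ∑ i, c i ≤ ∑ i ∈ Finset.univ.filter (fun i : Fin n => (i : ℕ) < k), (c i - 1) + ℓ +
        ∑ i, m i ∧
      m s = c k - ℓ ∧
      ∏ i, m i = (c k - ℓ) * ∏ i ∈ Finset.univ.filter (fun i : Fin n => (k : ℕ) + 1 ≤ i), c i := by
  have hck := hc1 k
  have hcs := hc1 s
  let m₀ : Fin n → ℕ := fun i => if (i : ℕ) < k then 1 else if i = k then c k - ℓ else c i
  have hm₀k : m₀ k = c k - ℓ := by simp [m₀]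
  have hm₀ : ∀ i, 1 ≤ m₀ i ∧ m₀ i ≤ c i := by
    intro i
    have := hc1 i
    simp only [m₀]
    split_ifs with h1 h2
    · omega
    · subst h2; omega
    · omega
  refine ⟨fun i => m₀ (Equiv.swap s k i), fun i => ?_, ?_, by simp [hm₀k], ?_⟩
  · by_cases his : i = s
    · subst his
      simp only [Equiv.swap_apply_left, hm₀k]
      omega
    by_cases hik : i = k
    · subst hik
      simp only [Equiv.swap_apply_right]
      exact ⟨(hm₀ s).1, (hm₀ s).2.trans hsk⟩
    simp only [Equiv.swap_apply_of_ne_of_ne his hik]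
    exact hm₀ i
  · rw [Equiv.sum_comp (Equiv.swap s k) m₀]
    have hℓsum : ℓ = ∑ i, if i = k then ℓ else 0 := by simp
    rw [hℓsum, Finset.sum_filter, ← Finset.sum_add_distrib, ← Finset.sum_add_distrib]
    refine Finset.sum_le_sum fun i _ => ?_
    have := hc1 i
    simp only [m₀]
    split_ifs with h1 h2 h3
    · omega
    · omega
    · subst h3; omega
    · omega
  · rw [Equiv.prod_comp (Equiv.swap s k) m₀, ← Finset.mul_prod_erase _ _ (Finset.mem_univ k), hm₀k,
      Finset.prod_filter, ← Finset.prod_erase (a := k) Finset.univ (by simp)]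
    congr 1
    refine Finset.prod_congr rfl fun i hi => ?_
    have hik := Finset.ne_of_mem_erase hi
    have hik' : (i : ℕ) ≠ k := fun h => hik (Fin.ext h)
    simp only [m₀, if_neg hik]
    split_ifs <;> omega

/-- with 2 ≤ d_1 ≤ ⋯ ≤ d_n, d = ∑_{i=1}^k (d_i - 1) + ℓ, 0 < ℓ ≤ d_{k+1} - 1,
if d_s ≤ d_{k+1} and 0 ≤ d_s - (d_{k+1} - ℓ) < r then
W¹(D_X^{(δ,s)}(d)) = W¹(C_X(d)) = (d_{k+1} - ℓ) ∏_{i=k+2}^n d_i.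
(Indices are 0-based: d_{k+1} is the card of K ⟨k⟩; the condition d_s - (d_{k+1} - ℓ) ≥ 0
is expressed as d_{k+1} - ℓ ≤ d_s.) -/
theorem minDist_quasiCode_case_ii
    (n : ℕ) (hn : 2 ≤ n) (K : Fin n → Set F) (hK : ∀ i, 2 ≤ (K i).ncard)
    (hmono : Monotone fun i => (K i).ncard)
    (δ : ℕ) (hδ : 2 ≤ δ) (s : Fin n) (hδs : δ ≤ (K s).ncard)
    (r : ℕ) (hrdef : r = (K s).ncard - δ + 1)
    (d k ℓ : ℕ) (hk : k < n)
    (hd : d = (∑ i ∈ Finset.univ.filter (fun i : Fin n => (i : ℕ) < k), ((K i).ncard - 1)) + ℓ)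
    (hℓ1 : 0 < ℓ) (hℓ2 : ℓ ≤ (K ⟨k, hk⟩).ncard - 1)
    (hcase1 : (K s).ncard ≤ (K ⟨k, hk⟩).ncard)
    (hcase2 : (K ⟨k, hk⟩).ncard - ℓ ≤ (K s).ncard)
    (hcase3 : (K s).ncard - ((K ⟨k, hk⟩).ncard - ℓ) < r) :
    minDist (quasiCode K d δ s) = minDist (cartCode K d) ∧
    minDist (cartCode K d) =
      ((K ⟨k, hk⟩).ncard - ℓ) *
        ∏ i ∈ Finset.univ.filter (fun i : Fin n => k + 1 ≤ (i : ℕ)), (K i).ncard := by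
  set k' : Fin n := ⟨k, hk⟩ with hk'
  have hlow : ∀ v ∈ cartCode K d, v ≠ 0 → ((K k').ncard - ℓ) *
      ∏ i ∈ Finset.univ.filter (fun i : Fin n => k + 1 ≤ (i : ℕ)), (K i).ncard ≤
        hammingNorm v := by
    intro v hv hv0
    obtain ⟨m, h1, h2, h3⟩ := exists_prod_le_hammingNorm K d v hv hv0
    exact (mul_prod_le_prod _ hmono m h1 k' ℓ hℓ2 (hd ▸ h2)).trans h3
  obtain ⟨m, h1, h2, h3, h4⟩ := exists_vector_attaining (fun i => (K i).ncard)
    (fun i => one_le_two.trans (hK i)) s k' ℓ hℓ2 hcase1 hcase2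
  obtain ⟨v, hv, hv0, hvw⟩ := exists_mem_quasiCode_hammingNorm_le K d δ s m h1 (hd ▸ h2)
    (by omega)
  have hle := quasiCode_le_cartCode K d δ s
  rw [h4] at hvw
  have hcart := minDist_eq_of_le (cartCode K d) _ hlow ⟨v, hle hv, hv0, hvw⟩
  refine ⟨?_, hcart⟩
  rw [hcart]
  exact minDist_eq_of_le _ _ (fun u hu => hlow u (hle hu)) ⟨v, hv, hv0, hvw⟩

end
end QACC
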